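/- Under the change of variables u₁ = β/r, u₂ = 1/r² (with r > 0), any solution of the fast system u̇₁ = u₁² − u₂ − ξu₁ − w₁, u̇₂ = u₁³/3 − u₁ − ξu₂ − w₂ (with w₁, w₂, ξ constant), after multiplying the vector field by r (time rescaling), satisfies β̇ = −(1/6)(β⁴ − 6β² + 6) + r(−βξ/2 + r(β²/2 − w₁) + (r²/2)βw₂) and ṙ = −(β³/6)r + (r²/2)(ξ + rβ + r²w₂). -/

import Mathlib

/-- Under the change of variables `β = u₁/√u₂`, `r = 1/√u₂` (so `u₁ = β/r`, `u₂ = 1/r²`),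
a solution of the fast Keyfitz–Kranzer system (with the vector field multiplied by `r`,
i.e. after the time rescaling) satisfies the compactified equations
`β̇ = −(1/6)(β⁴−6β²+6) + r(−βξ/2 + r(β²/2 − w₁) + (r²/2)βw₂)` and
`ṙ = −(β³/6)r + (r²/2)(ξ + rβ + r²w₂)`. -/
theorem compactified_equations (u₁ u₂ : ℝ → ℝ) (w₁ w₂ ξ σ : ℝ)
    (hpos : ∀ t, 0 < u₂ t)
    (β : ℝ → ℝ) (r : ℝ → ℝ)
    (hβ : β = fun t => u₁ t / Real.sqrt (u₂ t))
    (hr : r = fun t => 1 / Real.sqrt (u₂ t))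
    (hu₁ : HasDerivAt u₁ (r σ * ((u₁ σ) ^ 2 - u₂ σ - ξ * u₁ σ - w₁)) σ)
    (hu₂ : HasDerivAt u₂ (r σ * ((u₁ σ) ^ 3 / 3 - u₁ σ - ξ * u₂ σ - w₂)) σ) :
    HasDerivAt β
      (-(1 / 6) * ((β σ) ^ 4 - 6 * (β σ) ^ 2 + 6)
        + r σ * (-(β σ) * ξ / 2 + r σ * ((β σ) ^ 2 / 2 - w₁)
            + (r σ) ^ 2 / 2 * (β σ) * w₂)) σ ∧
    HasDerivAt r
      (-(β σ) ^ 3 / 6 * r σ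
        + (r σ) ^ 2 / 2 * (ξ + r σ * β σ + (r σ) ^ 2 * w₂)) σ := by
  have hp := hpos σ
  have hs : 0 < Real.sqrt (u₂ σ) := Real.sqrt_pos.mpr hp
  have hsq : u₂ σ = Real.sqrt (u₂ σ) ^ 2 := (Real.sq_sqrt hp.le).symm
  have hd := hu₂.sqrt hp.ne'
  have h1 := hu₁.div hd hs.ne'
  have h2 := (hasDerivAt_const σ (1 : ℝ)).div hd hs.ne'
  subst hβ hr
  constructor
  · refine HasDerivAt.congr_deriv h1 ?_
    simp only
    generalize Real.sqrt (u₂ σ) = s at *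
    rw [hsq]
    field_simp
    ring
  · refine HasDerivAt.congr_deriv h2 ?_
    simp only
    generalize Real.sqrt (u₂ σ) = s at *
    rw [hsq]
    field_simp
    ring
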